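/- arXiv:2307.02193 — 3 statements merged into one kernel-verified Lean document; each statement's English description precedes it below -/
import Mathlib

section
/- Let f : [m]^n → ℝ and let f* be its monotone rearrangement. Then E[|f − f*|] ≤ 2·d₁(f), where d₁(f) = inf over monotone g : [m]^n → ℝ of E[|f − g|], with expectations over the uniform measure on [m]^n. -/
/-- The sorted (non-decreasing) rearrangement of a tuple of reals. -/
noncomputable def sortTuple {m : ℕ} (f : Fin m → ℝ) : Fin m → ℝ := f ∘ Tuple.sort f

/-- The rearrangement (sorting) operator in direction `i` on the hypergrid `[m]ⁿ`:
on every line in direction `i`, it is the non-decreasing sorting of the restriction of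
`f` to that line. -/
noncomputable def sortDir {m n : ℕ} (i : Fin n) (f : (Fin n → Fin m) → ℝ) :
    (Fin n → Fin m) → ℝ :=
  fun x => sortTuple (fun t => f (Function.update x i t)) (x i)

/-- The monotone rearrangement `f* = Rₙ Rₙ₋₁ ⋯ R₁ f` on the hypergrid. -/
noncomputable def gridRearr {m n : ℕ} (f : (Fin n → Fin m) → ℝ) : (Fin n → Fin m) → ℝ :=
  (List.finRange n).foldl (fun g i => sortDir i g) f

/-- The discrete partial derivative `∂ᵢ f(x) = f(x + eᵢ) − f(x)` if `xᵢ < m`, and `0`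
if `xᵢ = m`. -/
noncomputable def dPartial {m n : ℕ} (i : Fin n) (f : (Fin n → Fin m) → ℝ)
    (x : Fin n → Fin m) : ℝ :=
  if h : (x i : ℕ) + 1 < m then f (Function.update x i ⟨(x i : ℕ) + 1, h⟩) - f x else 0

theorem sortTuple_mono {m : ℕ} {a b : Fin m → ℝ} (h : a ≤ b) : sortTuple a ≤ sortTuple b := by
  intro i
  by_contra! hlt
  have hmaps : ∀ j ∈ Finset.Iic i, ((Tuple.sort b).trans (Tuple.sort a).symm) j ∈ Finset.Iio i := by
    intro j hj
    rw [Finset.mem_Iic] at hj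
    rw [Finset.mem_Iio]
    by_contra! hij
    have h1 : sortTuple b j ≤ sortTuple b i := Tuple.monotone_sort b hj
    have h2 := Tuple.monotone_sort a hij
    have h3 := h (Tuple.sort b j)
    simp only [sortTuple, Function.comp_apply, Equiv.trans_apply, Equiv.apply_symm_apply]
      at h1 h2 hlt
    linarith
  have hcard := Finset.card_le_card_of_injOn _ hmaps
    ((Tuple.sort b).trans (Tuple.sort a).symm).injective.injOn
  simp at hcard

theorem sortTuple_of_monotone {m : ℕ} {a : Fin m → ℝ} (h : Monotone a) : sortTuple a = a := by
  rw [sortTuple, Tuple.sort_eq_refl_iff_monotone.mpr h]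
  rfl

theorem sortDir_mono {m n : ℕ} (i : Fin n) {f g : (Fin n → Fin m) → ℝ} (h : f ≤ g) :
    sortDir i f ≤ sortDir i g :=
  fun x => sortTuple_mono (fun _ => h _) (x i)

theorem sortDir_of_monotone {m n : ℕ} (i : Fin n) {g : (Fin n → Fin m) → ℝ} (h : Monotone g) :
    sortDir i g = g := by
  funext x
  have hline : Monotone fun t => g (Function.update x i t) :=
    h.comp Function.update_mono
  simp only [sortDir, sortTuple_of_monotone hline, Function.update_eq_self]

/-- Sorting along a direction permutes the points of the grid, hence preserves sums. -/
theorem sum_sortDir {m n : ℕ} (i : Fin n) (f : (Fin n → Fin m) → ℝ) :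
    ∑ x, sortDir i f x = ∑ x, f x := by
  let φ : (Fin n → Fin m) → (Fin n → Fin m) := fun x =>
    Function.update x i (Tuple.sort (fun t => f (Function.update x i t)) (x i))
  have hφ : Function.Injective φ := by
    intro x y hxy
    have hline : ∀ t, Function.update x i t = Function.update y i t := fun t => by
      simpa [φ] using congrArg (fun z => Function.update z i t) hxy
    have hi := congrFun hxy i
    simp only [φ, hline, Function.update_self, EmbeddingLike.apply_eq_iff_eq] at hi
    rw [← Function.update_eq_self i x, hline, hi, Function.update_eq_self]
  exact (Finite.injective_iff_bijective.mp hφ).sum_comp f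

theorem gridRearr_mono {m n : ℕ} {f g : (Fin n → Fin m) → ℝ} (h : f ≤ g) :
    gridRearr f ≤ gridRearr g := by
  unfold gridRearr
  induction List.finRange n generalizing f g with
  | nil => exact h
  | cons i l ih => exact ih (sortDir_mono i h)

theorem gridRearr_of_monotone {m n : ℕ} {g : (Fin n → Fin m) → ℝ} (h : Monotone g) :
    gridRearr g = g :=
  List.foldl_fixed' (fun i => sortDir_of_monotone i h) _

theorem sum_gridRearr {m n : ℕ} (f : (Fin n → Fin m) → ℝ) :
    ∑ x, gridRearr f x = ∑ x, f x := by
  unfold gridRearr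
  induction List.finRange n generalizing f with
  | nil => rfl
  | cons i l ih => exact (ih (sortDir i f)).trans (sum_sortDir i f)

/-- The monotone rearrangement is non-expansive in `L¹`. -/
theorem sum_abs_gridRearr_sub_le {m n : ℕ} (f g : (Fin n → Fin m) → ℝ) :
    ∑ x, |gridRearr f x - gridRearr g x| ≤ ∑ x, |f x - g x| := by
  calc ∑ x, |gridRearr f x - gridRearr g x|
      ≤ ∑ x, (gridRearr (f ⊔ g) x - gridRearr (f ⊓ g) x) := by
        refine Finset.sum_le_sum fun x _ => ?_
        have h1 := gridRearr_mono (le_sup_left : f ≤ f ⊔ g) x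
        have h2 := gridRearr_mono (le_sup_right : g ≤ f ⊔ g) x
        have h3 := gridRearr_mono (inf_le_left : f ⊓ g ≤ f) x
        have h4 := gridRearr_mono (inf_le_right : f ⊓ g ≤ g) x
        exact abs_sub_le_iff.mpr ⟨by linarith, by linarith⟩
    _ = ∑ x, |f x - g x| := by
        rw [Finset.sum_sub_distrib, sum_gridRearr, sum_gridRearr, ← Finset.sum_sub_distrib]
        refine Finset.sum_congr rfl fun x _ => ?_
        rw [Pi.sup_apply, Pi.inf_apply, sup_sub_inf_eq_abs_sub, abs_sub_comm]

/-- **The monotone rearrangement is essentially optimal on the hypergrid:**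
for `f : [m]ⁿ → ℝ`, `E[|f − f*|] ≤ 2 d₁(f)`, where `d₁(f)` is the `L¹` distance from `f`
to the monotone functions on `[m]ⁿ`, under the uniform measure. -/
theorem rearrangement_optimal_hypergrid {m n : ℕ} (f : (Fin n → Fin m) → ℝ) :
    (1 / (m ^ n : ℝ)) * ∑ x, |f x - gridRearr f x| ≤
      2 * sInf {d : ℝ | ∃ g : (Fin n → Fin m) → ℝ, Monotone g ∧
        d = (1 / (m ^ n : ℝ)) * ∑ x, |f x - g x|} := by
  rw [← div_le_iff₀' two_pos]
  refine le_csInf ⟨_, fun _ => 0, monotone_const, rfl⟩ ?_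
  rintro _ ⟨g, hg, rfl⟩
  rw [div_le_iff₀' two_pos, mul_left_comm]
  refine mul_le_mul_of_nonneg_left ?_ (by positivity)
  have hfg := sum_abs_gridRearr_sub_le g f
  rw [gridRearr_of_monotone hg] at hfg
  calc ∑ x, |f x - gridRearr f x|
      ≤ ∑ x, (|f x - g x| + |g x - gridRearr f x|) :=
        Finset.sum_le_sum fun x _ => abs_sub_le _ _ _
    _ ≤ 2 * ∑ x, |f x - g x| := by
        simp only [abs_sub_comm (g _) (f _)] at hfg
        rw [Finset.sum_add_distrib]
        linarith
end

section
/- Let B̄ = [0,a₁] × ⋯ × [0,aₙ] be the closure of the box of size a ∈ ℝⁿ with all a_i > 0, let f : B̄ → ℝ be Lipschitz continuous, and let i ∈ [n]. Then ∫_B |f − R_i f| dν ≤ 2·a_i · ∫_B |∂⁻_i f| dν, where ν is the Lebesgue measure on ℝⁿ and R_i is the rearrangement operator in direction i. -/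
open MeasureTheory

/-- The (lower) level set `{y ∈ [0,m] : g y ≤ c}`. -/
def levelSet (m : ℝ) (g : ℝ → ℝ) (c : ℝ) : Set ℝ :=
  {y : ℝ | y ∈ Set.Icc 0 m ∧ g y ≤ c}

/-- One-dimensional non-symmetric non-decreasing monotone rearrangement of `g` on `[0,m]`:
`g* x = inf {c : x ∈ (levelSet m g c)*}`, where `S* = [0, ν S]` for nonempty `S` and
`∅* = ∅`. -/
noncomputable def rearr1 (m : ℝ) (g : ℝ → ℝ) (x : ℝ) : ℝ :=
  sInf {c : ℝ | (levelSet m g c).Nonempty ∧ 0 ≤ x ∧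
    ENNReal.ofReal x ≤ volume (levelSet m g c)}

/-- The rearrangement operator in direction `i` on the box `[0,a₁] × ⋯ × [0,aₙ]`: on every
line in direction `i`, it is the one-dimensional monotone rearrangement of the restriction
of `f` to that line. -/
noncomputable def rearrDir {n : ℕ} (a : Fin n → ℝ) (i : Fin n) (f : (Fin n → ℝ) → ℝ) :
    (Fin n → ℝ) → ℝ :=
  fun x => rearr1 (a i) (fun t => f (Function.update x i t)) (x i)

/-- The monotone rearrangement `f* = Rₙ Rₙ₋₁ ⋯ R₁ f`. -/
noncomputable def monoRearr {n : ℕ} (a : Fin n → ℝ) (f : (Fin n → ℝ) → ℝ) :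
    (Fin n → ℝ) → ℝ :=
  (List.finRange n).foldl (fun g i => rearrDir a i g) f

/-- The partial derivative of `f` in coordinate `i` at `x` (junk value where the line
restriction of `f` is not differentiable). -/
noncomputable def pdiff {n : ℕ} (i : Fin n) (f : (Fin n → ℝ) → ℝ) (x : Fin n → ℝ) : ℝ :=
  deriv (fun t => f (Function.update x i t)) (x i)

/-- The monotone rearrangement on `[0,m]` depends only on the restriction to `[0,m]`. -/
theorem rearr1_congr {m : ℝ} {g h : ℝ → ℝ} (hgh : Set.EqOn g h (Set.Icc 0 m)) :
    rearr1 m g = rearr1 m h := by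
  have hlevel : levelSet m g = levelSet m h := by
    funext c
    ext y
    exact and_congr_right fun hy => by rw [hgh hy]
  funext x
  simp only [rearr1, hlevel]

/-- If a continuous function never decreases by more than `D` on `[0,m]`, then it is within
`D` of its monotone rearrangement. -/
theorem abs_sub_rearr1_le {m D : ℝ} {g : ℝ → ℝ} (hg : Continuous g)
    (hD : ∀ x y, 0 ≤ x → x ≤ y → y ≤ m → g x - g y ≤ D) {x : ℝ} (hx : x ∈ Set.Icc 0 m) :
    |g x - rearr1 m g x| ≤ D := by
  have hmem : g x + D ∈ {c : ℝ | (levelSet m g c).Nonempty ∧ 0 ≤ x ∧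
      ENNReal.ofReal x ≤ volume (levelSet m g c)} := by
    have hsub : Set.Icc 0 x ⊆ levelSet m g (g x + D) := fun y hy =>
      ⟨⟨hy.1, hy.2.trans hx.2⟩, by linarith [hD y x hy.1 hy.2 hx.2]⟩
    refine ⟨⟨x, hsub ⟨hx.1, le_rfl⟩⟩, hx.1, ?_⟩
    simpa using measure_mono (μ := volume) hsub
  have hlower : ∀ c ∈ {c : ℝ | (levelSet m g c).Nonempty ∧ 0 ≤ x ∧
      ENNReal.ofReal x ≤ volume (levelSet m g c)}, g x - D ≤ c := by
    rintro c ⟨hne, -, hvol⟩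
    by_contra! hc
    have hcompact : IsCompact (levelSet m g c) :=
      isCompact_Icc.inter_right (isClosed_le hg continuous_const)
    obtain ⟨z, hz, hmax⟩ := hcompact.exists_isGreatest hne
    have hzx : z < x := by
      by_contra! hxz
      linarith [hD x z hx.1 hxz hz.1.2, hz.2]
    have hsub : levelSet m g c ⊆ Set.Icc 0 z := fun y hy => ⟨hy.1.1, hmax hy⟩
    have hle := hvol.trans (measure_mono hsub)
    rw [Real.volume_Icc, sub_zero, ENNReal.ofReal_le_ofReal_iff hz.1.1] at hle
    linarith
  have hupper : rearr1 m g x ≤ g x + D := csInf_le ⟨_, hlower⟩ hmem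
  have hlow : g x - D ≤ rearr1 m g x := le_csInf ⟨_, hmem⟩ hlower
  rw [abs_le]
  constructor <;> linarith

theorem abs_min_zero_le (r : ℝ) : |min 0 r| ≤ |r| := by
  rcases le_total 0 r with h | h <;> simp [h]

/-- The negative part of the derivative of a Lipschitz function is integrable on bounded
intervals. -/
theorem LipschitzWith.integrableOn_abs_min_deriv {K : NNReal} {g : ℝ → ℝ}
    (hg : LipschitzWith K g) (a b : ℝ) :
    IntegrableOn (fun t => |min 0 (deriv g t)|) (Set.Icc a b) := by
  refine Measure.integrableOn_of_bounded (M := K) (by simp) ?_ ?_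
  · exact (measurable_const.min (measurable_deriv g)).abs.aestronglyMeasurable
  · refine Filter.Eventually.of_forall fun t => ?_
    rw [Real.norm_eq_abs, abs_abs]
    exact (abs_min_zero_le _).trans (norm_deriv_le_of_lipschitz hg)

/-- The total decrease of a Lipschitz function is bounded by the integral of the negative part
of its derivative. -/
theorem LipschitzWith.sub_le_integral_abs_min_deriv {K : NNReal} {g : ℝ → ℝ}
    (hg : LipschitzWith K g) {m x y : ℝ} (hx : 0 ≤ x) (hxy : x ≤ y) (hy : y ≤ m) :
    g x - g y ≤ ∫ t in Set.Icc 0 m, |min 0 (deriv g t)| := by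
  have hac : AbsolutelyContinuousOnInterval g x y :=
    (hg.lipschitzOnWith (s := Set.uIcc x y)).absolutelyContinuousOnInterval
  have hI := hg.integrableOn_abs_min_deriv 0 m
  have hsub : Set.Ioc x y ⊆ Set.Icc 0 m := fun t ht => ⟨hx.trans ht.1.le, ht.2.trans hy⟩
  calc g x - g y = ∫ t in x..y, -deriv g t := by
        rw [intervalIntegral.integral_neg, hac.integral_deriv_eq_sub]
        ring
    _ ≤ ∫ t in x..y, |min 0 (deriv g t)| := by
        refine intervalIntegral.integral_mono_on hxy hac.intervalIntegrable_deriv.neg ?_ ?_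
        · exact (intervalIntegrable_iff_integrableOn_Ioc_of_le hxy).2 (hI.mono_set hsub)
        · intro t _
          rcases le_total 0 (deriv g t) with h | h
          · simp [h]
          · simp [h, neg_le_abs]
    _ = ∫ t in Set.Ioc x y, |min 0 (deriv g t)| := intervalIntegral.integral_of_le hxy
    _ ≤ ∫ t in Set.Icc 0 m, |min 0 (deriv g t)| :=
        setIntegral_mono_set hI (Filter.Eventually.of_forall fun _ => abs_nonneg _)
          hsub.eventuallyLE

/-- Integrating out one coordinate and then integrating over the product multiplies the
integral by the mass of that coordinate's measure. -/
theorem lintegral_pi_lintegral_update {ι : Type*} [Fintype ι] [DecidableEq ι] {X : ι → Type*}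
    [∀ i, MeasurableSpace (X i)] (μ : ∀ i, Measure (X i)) [∀ i, SigmaFinite (μ i)]
    {h : (∀ i, X i) → ENNReal} (hh : Measurable h) (i : ι) :
    ∫⁻ x, ∫⁻ t, h (Function.update x i t) ∂μ i ∂Measure.pi μ =
      μ i Set.univ * ∫⁻ x, h x ∂Measure.pi μ := by
  have hm : Measurable fun x => ∫⁻ t, h (Function.update x i t) ∂μ i := by
    rw [← lmarginal_singleton]
    exact hh.lmarginal μ
  rw [← lintegral_const_mul _ hh]
  refine lintegral_eq_of_lmarginal_eq {i} hm (hh.const_mul _) ?_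
  simp only [lmarginal_singleton, Function.update_idem]
  funext x
  rw [lintegral_const, mul_comm]
  exact (lintegral_const_mul _ (hh.comp (measurable_update x))).symm

/-- Restricting a Lipschitz function to a coordinate line is Lipschitz. -/
theorem LipschitzWith.comp_update {ι : Type*} [Fintype ι] [DecidableEq ι] {K : NNReal}
    {F : (ι → ℝ) → ℝ} (hF : LipschitzWith K F) (x : ι → ℝ) (i : ι) :
    LipschitzWith K fun t => F (Function.update x i t) := by
  refine LipschitzWith.of_dist_le_mul fun s t => (hF.dist_le_mul _ _).trans ?_
  gcongr
  refine (dist_pi_le_iff dist_nonneg).2 fun j => ?_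
  rcases eq_or_ne j i with rfl | hj
  · simp
  · simp [hj]

theorem measurable_pdiff {n : ℕ} {F : (Fin n → ℝ) → ℝ} (hF : Continuous F) (i : Fin n) :
    Measurable (pdiff i F) := by
  have hc : Continuous (Function.uncurry fun (x : Fin n → ℝ) (t : ℝ) =>
      F (Function.update x i t)) :=
    hF.comp (continuous_fst.update i continuous_snd)
  exact (measurable_deriv_with_param hc).comp (measurable_id.prodMk (measurable_pi_apply i))

theorem update_mem_Icc_zero {n : ℕ} {a x : Fin n → ℝ} {i : Fin n} {t : ℝ}
    (hx : x ∈ Set.Icc 0 a) (ht : t ∈ Set.Icc 0 (a i)) : Function.update x i t ∈ Set.Icc 0 a := by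
  constructor <;> intro j <;> rcases eq_or_ne j i with rfl | hj
  · simpa using ht.1
  · simpa [hj] using hx.1 j
  · simpa using ht.2
  · simpa [hj] using hx.2 j

theorem rearrDir_eqOn {n : ℕ} {a : Fin n → ℝ} {f F : (Fin n → ℝ) → ℝ}
    (hfF : Set.EqOn f F (Set.Icc 0 a)) (i : Fin n) :
    Set.EqOn (rearrDir a i f) (rearrDir a i F) (Set.Icc 0 a) := fun x hx =>
  congrFun (rearr1_congr fun _ ht => hfF (update_mem_Icc_zero hx ht)) (x i)

theorem pdiff_ae_eq {n : ℕ} {a : Fin n → ℝ} {f F : (Fin n → ℝ) → ℝ}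
    (hfF : Set.EqOn f F (Set.Icc 0 a)) (i : Fin n) :
    pdiff i f =ᵐ[volume.restrict (Set.Icc 0 a)] pdiff i F := by
  have hne : ∀ c : ℝ, ∀ᵐ x : Fin n → ℝ, x i ≠ c := fun c =>
    Measure.ae_eval_ne (μ := fun _ : Fin n => (volume : Measure ℝ)) i c
  filter_upwards [ae_restrict_mem measurableSet_Icc, ae_restrict_of_ae (hne 0),
    ae_restrict_of_ae (hne (a i))] with x hx h0 ha
  refine Filter.EventuallyEq.deriv_eq ?_
  have hi : Set.Icc 0 (a i) ∈ nhds (x i) :=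
    Icc_mem_nhds ((hx.1 i).lt_of_ne' h0) ((hx.2 i).lt_of_ne ha)
  filter_upwards [hi] with t ht using hfF (update_mem_Icc_zero hx ht)

theorem volume_restrict_Icc_pi {n : ℕ} (a : Fin n → ℝ) :
    (volume : Measure (Fin n → ℝ)).restrict (Set.Icc 0 a) =
      Measure.pi fun j => (volume : Measure ℝ).restrict (Set.Icc 0 (a j)) := by
  rw [← Set.pi_univ_Icc]
  exact Measure.restrict_pi_pi (fun _ => volume) fun j => Set.Icc 0 (a j)

/-- Pointwise cost of rearranging a Lipschitz function in direction `i`. -/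
theorem LipschitzWith.enorm_abs_sub_rearrDir_le {n : ℕ} {a : Fin n → ℝ} {K : NNReal}
    {F : (Fin n → ℝ) → ℝ} (hF : LipschitzWith K F) (i : Fin n) {x : Fin n → ℝ}
    (hx : x ∈ Set.Icc 0 a) :
    ‖|F x - rearrDir a i F x|‖ₑ ≤
      ∫⁻ t in Set.Icc 0 (a i), ‖|min 0 (pdiff i F (Function.update x i t))|‖ₑ := by
  have hg := hF.comp_update x i
  have h := abs_sub_rearr1_le hg.continuous
    (fun _ _ hs hst ht => hg.sub_le_integral_abs_min_deriv hs hst ht)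
    (⟨hx.1 i, hx.2 i⟩ : x i ∈ Set.Icc 0 (a i))
  rw [Function.update_eq_self] at h
  have hpdiff : ∀ t, pdiff i F (Function.update x i t) =
      deriv (fun t => F (Function.update x i t)) t := fun t => by
    simp [pdiff]
  simp only [hpdiff]
  refine le_trans ?_ (enorm_integral_le_lintegral_enorm _)
  rw [enorm_le_iff_norm_le, Real.norm_eq_abs, abs_abs]
  exact h.trans (le_abs_self _)

/-- **Cost of rearranging in direction `i`:** for a Lipschitz function `f` on the box
`[0,a₁] × ⋯ × [0,aₙ]`, `∫_B |f − Rᵢ f| dν ≤ 2 aᵢ ∫_B |∂⁻ᵢ f| dν`. -/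
theorem rearrDir_cost {n : ℕ} (a : Fin n → ℝ) (ha : ∀ i, 0 < a i) (K : NNReal)
    (f : (Fin n → ℝ) → ℝ) (hf : LipschitzOnWith K f (Set.Icc 0 a)) (i : Fin n) :
    (∫ x in Set.Icc (0 : Fin n → ℝ) a, |f x - rearrDir a i f x|) ≤
      2 * a i * ∫ x in Set.Icc (0 : Fin n → ℝ) a, |min 0 (pdiff i f x)| := by
  obtain ⟨F, hF, hfF⟩ := hf.extend_real
  have hleft : ∫ x in Set.Icc (0 : Fin n → ℝ) a, |f x - rearrDir a i f x| =
      ∫ x in Set.Icc (0 : Fin n → ℝ) a, |F x - rearrDir a i F x| :=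
    setIntegral_congr_fun measurableSet_Icc fun x hx => by
      simp only [hfF hx, rearrDir_eqOn hfF i hx]
  have hright : ∫ x in Set.Icc (0 : Fin n → ℝ) a, |min 0 (pdiff i f x)| =
      ∫ x in Set.Icc (0 : Fin n → ℝ) a, |min 0 (pdiff i F x)| :=
    integral_congr_ae ((pdiff_ae_eq hfF i).mono fun x hx => by simp only [hx])
  rw [hleft, hright]
  have hmeas : Measurable fun x => |min 0 (pdiff i F x)| :=
    (measurable_const.min (measurable_pdiff hF.continuous i)).abs
  have hint : IntegrableOn (fun x => |min 0 (pdiff i F x)|) (Set.Icc 0 a) := by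
    refine Measure.integrableOn_of_bounded (M := K) isCompact_Icc.measure_lt_top.ne
      hmeas.aestronglyMeasurable (Filter.Eventually.of_forall fun x => ?_)
    rw [Real.norm_eq_abs, abs_abs]
    exact (abs_min_zero_le _).trans (norm_deriv_le_of_lipschitz (hF.comp_update x i))
  have hcost : ‖∫ x in Set.Icc (0 : Fin n → ℝ) a, |F x - rearrDir a i F x|‖ₑ ≤
      ‖a i * ∫ x in Set.Icc (0 : Fin n → ℝ) a, |min 0 (pdiff i F x)|‖ₑ := by
    calc _ ≤ ∫⁻ x in Set.Icc (0 : Fin n → ℝ) a, ‖|F x - rearrDir a i F x|‖ₑ :=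
          enorm_integral_le_lintegral_enorm _
      _ ≤ ∫⁻ x in Set.Icc (0 : Fin n → ℝ) a, ∫⁻ t in Set.Icc 0 (a i),
            ‖|min 0 (pdiff i F (Function.update x i t))|‖ₑ :=
          setLIntegral_mono' measurableSet_Icc fun x hx => hF.enorm_abs_sub_rearrDir_le i hx
      _ = ENNReal.ofReal (a i) *
            ∫⁻ x in Set.Icc (0 : Fin n → ℝ) a, ‖|min 0 (pdiff i F x)|‖ₑ := by
          rw [volume_restrict_Icc_pi, lintegral_pi_lintegral_update
            (fun j => (volume : Measure ℝ).restrict (Set.Icc 0 (a j))) hmeas.enorm i]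
          simp
      _ = _ := by
          rw [enorm_mul, Real.enorm_of_nonneg (ha i).le,
            Real.enorm_of_nonneg (integral_nonneg fun _ => abs_nonneg _),
            ofReal_integral_eq_lintegral_ofReal hint
              (Filter.Eventually.of_forall fun _ => abs_nonneg _)]
          simp only [Real.enorm_of_nonneg (abs_nonneg _)]
  have hnonneg : 0 ≤ a i * ∫ x in Set.Icc (0 : Fin n → ℝ) a, |min 0 (pdiff i F x)| :=
    mul_nonneg (ha i).le (integral_nonneg fun _ => abs_nonneg _)
  rw [enorm_le_iff_norm_le, Real.norm_eq_abs, Real.norm_eq_abs, abs_of_nonneg hnonneg] at hcost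
  linarith [le_abs_self (∫ x in Set.Icc (0 : Fin n → ℝ) a, |F x - rearrDir a i F x|)]
end

section
/- Let f : [m]^n → ℝ and let i, j ∈ [n]. Then Σ_{x ∈ [m]^n} |∂⁻_j (R_i f)(x)| ≤ Σ_{x ∈ [m]^n} |∂⁻_j f(x)|, where R_i is the sorting operator in direction i. -/
theorem sortTuple_monotone {m : ℕ} (a : Fin m → ℝ) : Monotone (sortTuple a) :=
  Tuple.monotone_sort a

theorem sum_sortTuple {m : ℕ} (a : Fin m → ℝ) : ∑ t, sortTuple a t = ∑ t, a t :=
  Equiv.sum_comp (Tuple.sort a) a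

/-- Sorting is monotone with respect to the pointwise order on tuples. -/
theorem sortTuple_le_sortTuple {m : ℕ} {a c : Fin m → ℝ} (h : a ≤ c) :
    sortTuple a ≤ sortTuple c := by
  intro k
  obtain ⟨l, hl, hkl⟩ : ∃ l ≤ k, k ≤ (Tuple.sort a).symm (Tuple.sort c l) := by
    by_contra! hlt
    have hcard : (Finset.Iic k).card ≤ (Finset.Iio k).card :=
      Finset.card_le_card_of_injOn (fun l => (Tuple.sort a).symm (Tuple.sort c l))
        (fun l hl => by simpa using hlt l (by simpa using hl))
        (((Tuple.sort a).symm.injective.comp (Tuple.sort c).injective).injOn)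
    simp at hcard
  calc sortTuple a k ≤ sortTuple a ((Tuple.sort a).symm (Tuple.sort c l)) :=
        sortTuple_monotone a hkl
    _ = a (Tuple.sort c l) := by simp [sortTuple]
    _ ≤ sortTuple c l := h _
    _ ≤ sortTuple c k := sortTuple_monotone c hl

theorem abs_min_zero_sub (u v : ℝ) : |min 0 (u - v)| = max u v - u := by
  rcases le_total u v with h | h
  · rw [min_eq_right (by linarith), max_eq_right h, abs_of_nonpos (by linarith)]
    ring
  · rw [min_eq_left (by linarith), max_eq_left h]
    simp

/-- Sorting two tuples simultaneously decreases the total negative part of their difference. -/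
theorem sum_abs_min_sortTuple_sub_le {m : ℕ} (a b : Fin m → ℝ) :
    ∑ t, |min 0 (sortTuple b t - sortTuple a t)| ≤ ∑ t, |min 0 (b t - a t)| := by
  simp only [abs_min_zero_sub, Finset.sum_sub_distrib, sum_sortTuple]
  have key : ∑ t, max (sortTuple b t) (sortTuple a t) ≤ ∑ t, sortTuple (b ⊔ a) t :=
    Finset.sum_le_sum fun t _ =>
      max_le (sortTuple_le_sortTuple le_sup_left t) (sortTuple_le_sortTuple le_sup_right t)
  rw [sum_sortTuple] at key
  exact sub_le_sub_right key _

/-- Sums over a product can be compared line by line. -/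
theorem sum_le_sum_of_lines {ι β : Type*} [Fintype ι] [DecidableEq ι] [Fintype β]
    (i : ι) (G H : (ι → β) → ℝ)
    (h : ∀ x, ∑ t, G (Function.update x i t) ≤ ∑ t, H (Function.update x i t)) :
    ∑ x, G x ≤ ∑ x, H x := by
  rw [← Equiv.sum_comp (Equiv.funSplitAt i β).symm G,
    ← Equiv.sum_comp (Equiv.funSplitAt i β).symm H, Fintype.sum_prod_type_right,
    Fintype.sum_prod_type_right]
  refine Finset.sum_le_sum fun y _ => ?_
  cases isEmpty_or_nonempty β with
  | inl _ => simp
  | inr hβ =>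
    obtain ⟨s⟩ := hβ
    have hup (t : β) : (Equiv.funSplitAt i β).symm (t, y) =
        Function.update ((Equiv.funSplitAt i β).symm (s, y)) i t := by
      ext k
      by_cases hk : k = i
      · subst hk
        simp
      · simp [hk]
    have hsum (F : (ι → β) → ℝ) := Fintype.sum_congr _ _ fun t => congrArg F (hup t)
    rw [hsum G, hsum H]
    exact h _

theorem sortDir_update {m n : ℕ} (i : Fin n) (f : (Fin n → Fin m) → ℝ) (x : Fin n → Fin m)
    (t : Fin m) :
    sortDir i f (Function.update x i t) = sortTuple (fun u => f (Function.update x i u)) t := by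
  simp [sortDir]

theorem dPartial_sortDir_self_nonneg {m n : ℕ} (i : Fin n) (f : (Fin n → Fin m) → ℝ)
    (x : Fin n → Fin m) : 0 ≤ dPartial i (sortDir i f) x := by
  unfold dPartial
  split_ifs with h
  · rw [sortDir_update, sub_nonneg]
    exact sortTuple_monotone _ (Fin.le_def.2 (Nat.le_succ _))
  · exact le_rfl

/-- **Sorting in direction `i` only decreases the violations of monotonicity in any
direction `j`:** `Σₓ |∂⁻ⱼ (Rᵢ f)(x)| ≤ Σₓ |∂⁻ⱼ f(x)|` on the hypergrid `[m]ⁿ`. -/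
theorem sortDir_decreases_violations {m n : ℕ} (f : (Fin n → Fin m) → ℝ) (i j : Fin n) :
    ∑ x, |min 0 (dPartial j (sortDir i f) x)| ≤ ∑ x, |min 0 (dPartial j f x)| := by
  rcases eq_or_ne j i with rfl | hji
  · refine Finset.sum_le_sum fun x _ => ?_
    rw [min_eq_left (dPartial_sortDir_self_nonneg j f x), abs_zero]
    exact abs_nonneg _
  · refine sum_le_sum_of_lines i _ _ fun x => ?_
    simp only [dPartial, Function.update_of_ne hji]
    split_ifs with h
    · simp only [Function.update_comm hji.symm, sortDir_update]
      exact sum_abs_min_sortTuple_sub_le (fun u => f (Function.update x i u))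
        (fun u => f (Function.update (Function.update x j ⟨(x j : ℕ) + 1, h⟩) i u))
    · exact le_rfl
end
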